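/- Let τ be in the complex upper half-plane and let u ∈ ℂ with u ∉ ℤτ + (1/3)ℤ. Then R*(e^{2πiu}; e^{2πiτ}) = i e^{−3πiu − πiτ/4} μ(3u, −τ; 3τ) − i e^{πiu − πiτ/4} μ(3u, τ; 3τ) − i e^{−πiu + πiτ/12} η(3τ)³ / ( η(τ) ϑ(3u; 3τ) ). -/

import Mathlib

open Complex Real Filter

noncomputable section

/-- The Jacobi theta function ϑ(u;τ) = Σ_{ν∈ℤ+1/2} e^{πiν²τ + 2πiν(u+1/2)}. -/
def jTheta (u τ : ℂ) : ℂ :=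
  ∑' n : ℤ, Complex.exp (π * I * ((n : ℂ) + 1/2)^2 * τ + 2 * π * I * ((n : ℂ) + 1/2) * (u + 1/2))

/-- ϑ₀(u;τ) = Σ_{n∈ℤ} e^{πin²τ + 2πinu}. -/
def jTheta0 (u τ : ℂ) : ℂ :=
  ∑' n : ℤ, Complex.exp (π * I * (n : ℂ)^2 * τ + 2 * π * I * (n : ℂ) * u)

/-- ϑ₁(u;τ) = Σ_{n∈1/2+ℤ} e^{πin²τ + 2πinu}. -/
def jTheta1 (u τ : ℂ) : ℂ :=
  ∑' n : ℤ, Complex.exp (π * I * ((n : ℂ) + 1/2)^2 * τ + 2 * π * I * ((n : ℂ) + 1/2) * u)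

/-- The Dedekind eta function. -/
def dedekindEta (τ : ℂ) : ℂ :=
  Complex.exp (π * I * τ / 12) * ∏' n : ℕ, (1 - Complex.exp (2 * π * I * ((n : ℂ) + 1) * τ))

/-- The Lerch sum μ(u,v;τ). -/
def lerchMu (u v τ : ℂ) : ℂ :=
  Complex.exp (π * I * u) / jTheta v τ *
    ∑' n : ℤ, (-1 : ℂ) ^ n * Complex.exp (π * I * ((n : ℂ)^2 + (n : ℂ)) * τ + 2 * π * I * v * (n : ℂ)) /
      (1 - Complex.exp (2 * π * I * (n : ℂ) * τ + 2 * π * I * u))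

/-- a₀^{α,β}(τ). -/
def aCoef0 (α β : ℝ) (τ : ℂ) : ℂ :=
  ∑' n : ℤ, ((n : ℂ) + (α : ℂ)/2) *
    Complex.exp (2 * π * I * (n : ℂ)^2 * τ + 2 * π * I * (n : ℂ) * ((α : ℂ) * τ + (β : ℂ)))

/-- a₁^{α,β}(τ). -/
def aCoef1 (α β : ℝ) (τ : ℂ) : ℂ :=
  ∑' n : ℤ, (((n : ℂ) + 1/2) + (α : ℂ)/2) *
    Complex.exp (2 * π * I * ((n : ℂ) + 1/2)^2 * τ + 2 * π * I * ((n : ℂ) + 1/2) * ((α : ℂ) * τ + (β : ℂ)))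

/-- Finite q-Pochhammer symbol (a;q)_n. -/
def qPochN (a q : ℂ) (n : ℕ) : ℂ := ∏ j ∈ Finset.range n, (1 - a * q ^ j)

/-- Infinite q-Pochhammer symbol (a;q)_∞. -/
def qPochInf (a q : ℂ) : ℂ := ∏' j : ℕ, (1 - a * q ^ j)

/-- The modified rank generating function R*(z;q). -/
def rankStar (z q : ℂ) : ℂ :=
  (qPochInf q q)⁻¹ * ∑' n : ℤ, (-1 : ℂ) ^ n * q ^ (n * (3 * n + 1) / 2) / (1 - z * q ^ n)

/-- The modified crank generating function C*(z;q). -/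
def crankStar (z q : ℂ) : ℂ :=
  (1 - z)⁻¹ * ∏' n : ℕ, ((1 - q ^ (n + 1)) / ((1 - z * q ^ (n + 1)) * (1 - z⁻¹ * q ^ (n + 1))))

/-- N(1,0,z;q), the overpartition-rank generating function. -/
def nGen10 (z q : ℂ) : ℂ :=
  ∑' n : ℕ, qPochN (-1) q n * q ^ (n * (n + 1) / 2) / (qPochN (z * q) q n * qPochN (z⁻¹ * q) q n)

/-- N*(1,0,z;q). -/
def nStar10 (z q : ℂ) : ℂ := nGen10 z q / (1 - z)

/-- N(1,1/q,z;q²), the M2-rank generating function for overpartitions. -/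
def nGenM2over (z q : ℂ) : ℂ :=
  ∑' n : ℕ, qPochN (-1) (q^2) n * qPochN (-q) (q^2) n * q ^ n /
    (qPochN (z * q^2) (q^2) n * qPochN (z⁻¹ * q^2) (q^2) n)

/-- N*(1,1/q,z;q²). -/
def nStarM2over (z q : ℂ) : ℂ := nGenM2over z q / (1 - z)

/-- N(0,1/q,z;q²), the M2-rank generating function for partitions without repeated odd parts. -/
def nGenM2 (z q : ℂ) : ℂ :=
  ∑' n : ℕ, qPochN (-q) (q^2) n * q ^ (n^2) /
    (qPochN (z * q^2) (q^2) n * qPochN (z⁻¹ * q^2) (q^2) n)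

/-- N*(0,1/q,z;q²). -/
def nStarM2 (z q : ℂ) : ℂ := nGenM2 z q / (1 - z)

/-- The odd-rank generating function R^o(z;q). -/
def oddRank (z q : ℂ) : ℂ :=
  (qPochInf (q^2) (q^2))⁻¹ * ∑' n : ℤ, (-1 : ℂ) ^ n * q ^ (3 * n^2 + 3 * n + 1) / (1 - z * q ^ (2 * n + 1))


/-- The general term of the theta series Σ (-1)^n w^n q^{n(n-1)/2}. -/
def thetaTerm (w q : ℂ) (n : ℤ) : ℂ := (-1 : ℂ) ^ n * w ^ n * q ^ (n * (n - 1) / 2)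

/-- The theta series Σ_{n∈ℤ} (-1)^n w^n q^{n(n-1)/2}. -/
def thetaSeries (w q : ℂ) : ℂ := ∑' n : ℤ, thetaTerm w q n

/-- The Appell–Lerch series Σ_{n∈ℤ} (-1)^n x^n q^{n(n-1)/2} / (1 - w q^n). -/
def lerchSeries (x w q : ℂ) : ℂ := ∑' n : ℤ, thetaTerm x q n / (1 - w * q ^ n)

/-- The reciprocal 1/(q;q)_k, extended by zero to negative `k`. -/
def invPoch (q : ℂ) (k : ℤ) : ℂ := if 0 ≤ k then (qPochN q q k.toNat)⁻¹ else 0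

lemma half_mul_succ (n : ℤ) : (n + 1) * n / 2 = n * (n - 1) / 2 + n := by
  rw [show (n + 1) * n = n * (n - 1) + n * 2 by ring, Int.add_mul_ediv_right _ _ two_ne_zero]

lemma thetaTerm_add_one {w q : ℂ} (hw : w ≠ 0) (hq : q ≠ 0) (n : ℤ) :
    thetaTerm w q (n + 1) = -w * q ^ n * thetaTerm w q n := by
  have h : (n + 1) * (n + 1 - 1) / 2 = n * (n - 1) / 2 + n := by
    rw [add_sub_cancel_right, half_mul_succ]
  rw [thetaTerm, thetaTerm, h, zpow_add₀ hq, zpow_add₀ hw, zpow_add₀ (by norm_num : (-1 : ℂ) ≠ 0),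
    zpow_one, zpow_one]
  ring

lemma thetaTerm_mul {w x q : ℂ} (n : ℤ) : thetaTerm (w * x) q n = thetaTerm w q n * x ^ n := by
  rw [thetaTerm, thetaTerm, mul_zpow]
  ring

lemma pow_ne_one_of_norm_lt_one {q : ℂ} (hq1 : ‖q‖ < 1) {n : ℕ} (hn : n ≠ 0) : q ^ n ≠ 1 := by
  intro h
  have := pow_lt_one₀ (norm_nonneg q) hq1 hn
  rw [← norm_pow, h, norm_one] at this
  exact lt_irrefl _ this

lemma qPochN_self_ne_zero {q : ℂ} (hq1 : ‖q‖ < 1) (n : ℕ) : qPochN q q n ≠ 0 := by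
  refine Finset.prod_ne_zero_iff.2 fun j _ => ?_
  rw [← pow_succ', sub_ne_zero]
  exact (pow_ne_one_of_norm_lt_one hq1 j.succ_ne_zero).symm

lemma invPoch_mul_one_sub {q : ℂ} (hq1 : ‖q‖ < 1) (k : ℤ) :
    invPoch q k * (1 - q ^ k) = invPoch q (k - 1) := by
  rcases lt_trichotomy k 0 with hk | rfl | hk
  · rw [invPoch, invPoch, if_neg (by omega), if_neg (by omega), zero_mul]
  · simp [invPoch]
  · obtain ⟨n, rfl⟩ : ∃ n : ℕ, k = n + 1 := ⟨(k - 1).toNat, by omega⟩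
    have h := qPochN_self_ne_zero hq1 (n + 1)
    have h2 : qPochN q q (n + 1) = qPochN q q n * (1 - q ^ (n + 1)) := by
      rw [qPochN, Finset.prod_range_succ, pow_succ' q n, qPochN]
    rw [invPoch, invPoch, if_pos (by omega), if_pos (by omega),
      show ((n : ℤ) + 1).toNat = n + 1 by omega, show ((n : ℤ) + 1 - 1).toNat = n by omega]
    have h3 : (q : ℂ) ^ ((n : ℤ) + 1) = q ^ (n + 1) := by exact_mod_cast zpow_natCast q (n + 1)
    rw [h3]
    rw [h2] at h ⊢
    have := left_ne_zero_of_mul h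
    have := right_ne_zero_of_mul h
    field_simp

lemma summable_norm_mul_geometric {q : ℂ} (hq1 : ‖q‖ < 1) (a : ℂ) :
    Summable fun n : ℕ => ‖-(a * q ^ n)‖ := by
  simp_rw [norm_neg, norm_mul, norm_pow]
  exact (summable_geometric_of_lt_one (norm_nonneg q) hq1).mul_left _

lemma tendsto_qPochN {q : ℂ} (hq1 : ‖q‖ < 1) (a : ℂ) :
    Tendsto (qPochN a q) atTop (nhds (qPochInf a q)) := by
  have h := (multipliable_one_add_of_summable (summable_norm_mul_geometric hq1 a)).tendsto_prod_tprod_nat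
  simp_rw [← sub_eq_add_neg] at h
  exact h

lemma qPochInf_ne_zero {a q : ℂ} (hq1 : ‖q‖ < 1) (ha : ∀ n : ℕ, 1 - a * q ^ n ≠ 0) :
    qPochInf a q ≠ 0 := by
  have h := tprod_one_add_ne_zero_of_summable (f := fun n : ℕ => -(a * q ^ n))
    (by simpa [← sub_eq_add_neg] using ha) (summable_norm_mul_geometric hq1 a)
  simp_rw [← sub_eq_add_neg] at h
  exact h

lemma qPochInf_self_ne_zero {q : ℂ} (hq1 : ‖q‖ < 1) : qPochInf q q ≠ 0 := by
  refine qPochInf_ne_zero hq1 fun n => ?_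
  rw [← pow_succ', sub_ne_zero]
  exact (pow_ne_one_of_norm_lt_one hq1 n.succ_ne_zero).symm

lemma tendsto_int_toNat_atTop : Tendsto Int.toNat atTop atTop :=
  tendsto_atTop.2 fun n : ℕ => (eventually_ge_atTop (n : ℤ)).mono fun k hk => by omega

lemma tendsto_invPoch {q : ℂ} (hq1 : ‖q‖ < 1) :
    Tendsto (invPoch q) atTop (nhds (qPochInf q q)⁻¹) := by
  have h := ((tendsto_qPochN hq1 q).inv₀ (qPochInf_self_ne_zero hq1)).comp tendsto_int_toNat_atTop
  refine h.congr' ?_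
  filter_upwards [eventually_ge_atTop 0] with k hk
  simp [invPoch, hk]

lemma exists_norm_invPoch_le {q : ℂ} (hq1 : ‖q‖ < 1) : ∃ C : ℝ, 0 ≤ C ∧ ∀ k, ‖invPoch q k‖ ≤ C := by
  obtain ⟨C, hC⟩ := (Metric.isBounded_range_of_tendsto _
    ((tendsto_qPochN hq1 q).inv₀ (qPochInf_self_ne_zero hq1))).exists_norm_le
  refine ⟨C, (norm_nonneg _).trans (hC _ ⟨0, rfl⟩), fun k => ?_⟩
  rw [invPoch]
  split_ifs
  · exact hC _ ⟨_, rfl⟩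
  · simpa using (norm_nonneg _).trans (hC _ ⟨0, rfl⟩)

lemma intCast_half_mul_pred (n : ℤ) : ((n * (n - 1) / 2 : ℤ) : ℂ) = n * (n - 1) / 2 := by
  rw [Int.cast_div (Int.even_mul_pred_self n).two_dvd (by norm_num)]
  push_cast
  rfl

lemma thetaTerm_exp (a s : ℂ) (n : ℤ) :
    thetaTerm (Complex.exp a) (Complex.exp s) n
      = Complex.exp (n * (π * I + a) + n * (n - 1) / 2 * s) := by
  rw [thetaTerm, ← Complex.exp_int_mul, ← Complex.exp_int_mul, ← Complex.exp_pi_mul_I,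
    ← Complex.exp_int_mul, ← Complex.exp_add, ← Complex.exp_add, intCast_half_mul_pred]
  ring_nf

lemma summable_thetaTerm {w q : ℂ} (hw : w ≠ 0) (hq : q ≠ 0) (hq1 : ‖q‖ < 1) :
    Summable (thetaTerm w q) := by
  have hlog : (Complex.log q).re < 0 := by
    rw [Complex.log_re]
    exact Real.log_neg (norm_pos_iff.2 hq) hq1
  have hpi : (π : ℂ) ≠ 0 := by exact_mod_cast Real.pi_ne_zero
  have hτ : 0 < (Complex.log q / (2 * π * I)).im := by
    have h : Complex.log q / (2 * π * I) = ((2 * π)⁻¹ : ℝ) * (-I * Complex.log q) := by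
      push_cast
      field_simp
      rw [I_sq]
      ring
    rw [h, Complex.im_ofReal_mul]
    have : 0 < (2 * π)⁻¹ := by positivity
    refine mul_pos this ?_
    simpa using hlog
  refine ((summable_jacobiTheta₂_term_iff ((π * I + Complex.log w - Complex.log q / 2) / (2 * π * I))
    _).2 hτ).congr fun n => ?_
  conv_rhs => rw [← Complex.exp_log hw, ← Complex.exp_log hq, thetaTerm_exp]
  rw [jacobiTheta₂_term]
  congr 1
  field_simp
  ring

lemma eventually_half_le_norm_one_sub {w q : ℂ} (hw : w ≠ 0) (hq : q ≠ 0) (hq1 : ‖q‖ < 1) :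
    ∀ᶠ n : ℤ in cofinite, 1 / 2 ≤ ‖1 - w * q ^ n‖ := by
  have hw' := norm_pos_iff.2 hw
  have hq' := norm_pos_iff.2 hq
  have key : ∀ c : ℝ, Tendsto (fun n : ℕ => c * ‖q‖ ^ n) atTop (nhds 0) := fun c => by
    simpa using (tendsto_pow_atTop_nhds_zero_of_lt_one hq'.le hq1).const_mul c
  rw [Int.cofinite_eq, eventually_sup]
  constructor
  · have h3 := ((key (‖w‖⁻¹)).comp (tendsto_int_toNat_atTop.comp
      tendsto_neg_atBot_atTop)).eventually_le_const (show (0 : ℝ) < 1 / 2 by norm_num)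
    filter_upwards [h3, eventually_le_atBot 0] with n hn hn0
    obtain ⟨k, rfl⟩ : ∃ k : ℕ, n = -k := ⟨(-n).toNat, by omega⟩
    simp only [Function.comp_apply, neg_neg, Int.toNat_natCast] at hn
    have h4 : 2 ≤ ‖w * q ^ (-(k : ℤ))‖ := by
      rw [norm_mul, zpow_neg, norm_inv, zpow_natCast, norm_pow]
      rw [inv_mul_le_iff₀ hw'] at hn
      rw [← div_eq_mul_inv, le_div_iff₀ (by positivity)]
      linarith
    have := norm_sub_norm_le (w * q ^ (-(k : ℤ))) 1
    rw [norm_one, norm_sub_rev] at this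
    linarith
  · have h3 := ((key ‖w‖).comp tendsto_int_toNat_atTop).eventually_le_const
      (show (0 : ℝ) < 1 / 2 by norm_num)
    filter_upwards [h3, eventually_ge_atTop 0] with n hn hn0
    obtain ⟨k, rfl⟩ : ∃ k : ℕ, n = k := ⟨n.toNat, by omega⟩
    simp only [Function.comp_apply, Int.toNat_natCast] at hn
    have := norm_sub_norm_le 1 (w * q ^ (k : ℤ))
    rw [norm_one, norm_mul, zpow_natCast, norm_pow] at this
    rw [zpow_natCast]
    linarith

lemma summable_lerchTerm {x w q : ℂ} (hx : x ≠ 0) (hw : w ≠ 0) (hq : q ≠ 0) (hq1 : ‖q‖ < 1) :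
    Summable fun n : ℤ => thetaTerm x q n / (1 - w * q ^ n) := by
  refine summable_of_isBigO (summable_thetaTerm hx hq hq1).norm ?_
  refine Asymptotics.IsBigO.of_bound 2 ?_
  filter_upwards [eventually_half_le_norm_one_sub hw hq hq1] with n hn
  rw [norm_div, norm_norm, div_le_iff₀ (by linarith)]
  nlinarith [norm_nonneg (thetaTerm x q n)]

/-- Multiplying the terms of a summable series by `1/((q;q)_{a-n} (q;q)_{b+n})` preserves
summability. -/
lemma summable_mul_invPoch {f : ℤ → ℂ} (hf : Summable f) {q : ℂ} (hq1 : ‖q‖ < 1) (a b : ℤ) :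
    Summable fun n => f n * (invPoch q (a - n) * invPoch q (b + n)) := by
  obtain ⟨C, hC0, hC⟩ := exists_norm_invPoch_le hq1
  refine Summable.of_norm_bounded (hf.norm.mul_right (C * C)) fun n => ?_
  rw [norm_mul, norm_mul]
  gcongr
  exacts [hC _, hC _]

lemma tendsto_tsum_mul_invPoch {f : ℤ → ℂ} (hf : Summable f) {q : ℂ} (hq1 : ‖q‖ < 1) :
    Tendsto (fun N : ℕ => ∑' n, f n * (invPoch q (N - n) * invPoch q (N + n))) atTop
      (nhds ((∑' n, f n) * ((qPochInf q q)⁻¹ * (qPochInf q q)⁻¹))) := by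
  obtain ⟨C, hC0, hC⟩ := exists_norm_invPoch_le hq1
  rw [← tsum_mul_right]
  refine tendsto_tsum_of_dominated_convergence (hf.norm.mul_right (C * C)) (fun n => ?_) ?_
  · refine ((((tendsto_invPoch hq1).comp ?_).mul ((tendsto_invPoch hq1).comp ?_)).const_mul _)
    · exact tendsto_atTop_add_const_right _ (-n) tendsto_natCast_atTop_atTop
    · exact tendsto_atTop_add_const_right _ n tendsto_natCast_atTop_atTop
  · refine Eventually.of_forall fun N n => ?_
    rw [norm_mul, norm_mul]
    gcongr
    exacts [hC _, hC _]

/-- The theta series truncated by the weights `1/((q;q)_{a-n} (q;q)_{b+n})`. -/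
def thetaTrunc (w q : ℂ) (a b : ℤ) : ℂ :=
  ∑' n : ℤ, thetaTerm w q n * (invPoch q (a - n) * invPoch q (b + n))

lemma thetaTrunc_add_one_left {w q : ℂ} (hw : w ≠ 0) (hq : q ≠ 0) (hq1 : ‖q‖ < 1) (a b : ℤ) :
    thetaTrunc w q (a + 1) b * (1 - q ^ (a + b + 1)) = (1 - w * q ^ a) * thetaTrunc w q a b := by
  have hs := summable_mul_invPoch (summable_thetaTerm hw hq hq1) hq1
  have h1 := (hs a b).hasSum
  have h2 := ((Equiv.addRight (-1 : ℤ)).hasSum_iff.2 h1).mul_left (w * q ^ a)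
  have h3 := ((hs (a + 1) b).hasSum).mul_right (1 - q ^ (a + b + 1))
  rw [sub_mul, one_mul]
  refine h3.unique ((h1.sub h2).congr_fun fun n => ?_)
  have e1 := invPoch_mul_one_sub hq1 (a + 1 - n)
  have e2 := invPoch_mul_one_sub hq1 (b + n)
  have e3 := thetaTerm_add_one hw hq (n - 1)
  rw [sub_add_cancel] at e3
  have e4 : q ^ a = q ^ (a + 1 - n) * q ^ (n - 1) := by
    rw [← zpow_add₀ hq]
    ring_nf
  simp only [Function.comp_apply, Equiv.coe_addRight]
  rw [show a - n = a + 1 - n - 1 by ring, ← e1, show a - (n + -1) = a + 1 - n by ring,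
    show b + (n + -1) = b + n - 1 by ring, ← e2, ← sub_eq_add_neg, e3,
    show a + b + 1 = (a + 1 - n) + (b + n) by ring, zpow_add₀ hq, e4]
  ring

lemma thetaTrunc_add_one_right {w q : ℂ} (hw : w ≠ 0) (hq : q ≠ 0) (hq1 : ‖q‖ < 1) (a b : ℤ) :
    thetaTrunc w q a (b + 1) * (1 - q ^ (a + b + 1))
      = (1 - q ^ (b + 1) / w) * thetaTrunc w q a b := by
  have hs := summable_mul_invPoch (summable_thetaTerm hw hq hq1) hq1
  have h1 := (hs a b).hasSum
  have h2 := ((Equiv.addRight (1 : ℤ)).hasSum_iff.2 h1).mul_left (q ^ (b + 1) / w)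
  have h3 := ((hs a (b + 1)).hasSum).mul_right (1 - q ^ (a + b + 1))
  rw [sub_mul, one_mul]
  refine h3.unique ((h1.sub h2).congr_fun fun n => ?_)
  have e1 := invPoch_mul_one_sub hq1 (b + 1 + n)
  have e2 := invPoch_mul_one_sub hq1 (a - n)
  have e3 := thetaTerm_add_one hw hq n
  simp only [Function.comp_apply, Equiv.coe_addRight]
  rw [e3, show b + n = b + 1 + n - 1 by ring, ← e1, show a - (n + 1) = a - n - 1 by ring, ← e2,
    show b + (n + 1) = b + 1 + n by ring,
    show a + b + 1 = (a - n) + (b + 1 + n) by ring, zpow_add₀ hq,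
    zpow_add₀ hq (b + 1) n]
  field_simp
  ring

lemma qPochN_succ (a q : ℂ) (n : ℕ) : qPochN a q (n + 1) = qPochN a q n * (1 - a * q ^ n) :=
  Finset.prod_range_succ _ _

lemma tsum_mul_invPoch_zero (f : ℤ → ℂ) (q : ℂ) :
    ∑' n : ℤ, f n * (invPoch q (0 - n) * invPoch q (0 + n)) = f 0 := by
  rw [tsum_eq_single 0]
  · simp [invPoch, qPochN]
  · intro n hn
    rcases lt_or_gt_of_ne hn with h | h
    · rw [invPoch, invPoch, if_neg (by omega : ¬ 0 ≤ 0 + n)]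
      simp
    · rw [invPoch, if_neg (by omega)]
      simp

/-- The finite Jacobi triple product identity. -/
lemma thetaTrunc_mul_qPochN {w q : ℂ} (hw : w ≠ 0) (hq : q ≠ 0) (hq1 : ‖q‖ < 1) (N : ℕ) :
    thetaTrunc w q N N * qPochN q q (2 * N) = qPochN w q N * qPochN (q / w) q N := by
  induction N with
  | zero =>
    rw [thetaTrunc, Nat.cast_zero, tsum_mul_invPoch_zero]
    simp [thetaTerm, qPochN]
  | succ N ih =>
    have h1 := thetaTrunc_add_one_left hw hq hq1 N N
    have h2 := thetaTrunc_add_one_right hw hq hq1 (N + 1) N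
    rw [show 2 * (N + 1) = 2 * N + 1 + 1 by ring, qPochN_succ, qPochN_succ, qPochN_succ,
      qPochN_succ]
    have e1 : q ^ ((N : ℤ) + N + 1) = q * q ^ (2 * N) := by
      rw [← pow_succ', ← zpow_natCast]
      congr 1
      push_cast
      ring
    have e2 : q ^ ((N : ℤ) + 1 + N + 1) = q * q ^ (2 * N + 1) := by
      rw [← pow_succ', ← zpow_natCast]
      congr 1
      push_cast
      ring
    have e3 : q ^ ((N : ℤ) + 1) = q * q ^ N := by
      rw [← pow_succ', ← zpow_natCast]
      push_cast
      rfl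
    rw [e1, zpow_natCast] at h1
    rw [e2, e3] at h2
    push_cast
    calc _ = thetaTrunc w q (N + 1) (N + 1) * (1 - q * q ^ (2 * N + 1)) *
          (qPochN q q (2 * N) * (1 - q * q ^ (2 * N))) := by ring
      _ = (1 - q * q ^ N / w) * qPochN q q (2 * N) *
          (thetaTrunc w q (N + 1) N * (1 - q * q ^ (2 * N))) := by rw [h2]; ring
      _ = (1 - q * q ^ N / w) * (1 - w * q ^ N) *
          (thetaTrunc w q N N * qPochN q q (2 * N)) := by rw [h1]; ring
      _ = _ := by rw [ih]; ring

/-- The Jacobi triple product identity. -/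
lemma thetaSeries_eq {w q : ℂ} (hw : w ≠ 0) (hq : q ≠ 0) (hq1 : ‖q‖ < 1) :
    thetaSeries w q = qPochInf q q * qPochInf w q * qPochInf (q / w) q := by
  have h1 := (tendsto_tsum_mul_invPoch (summable_thetaTerm hw hq hq1) hq1).mul
    ((tendsto_qPochN hq1 q).comp (tendsto_id.const_mul_atTop' (show 0 < 2 by norm_num)))
  have h2 := (tendsto_qPochN hq1 w).mul (tendsto_qPochN hq1 (q / w))
  have h := tendsto_nhds_unique (h1.congr (thetaTrunc_mul_qPochN hw hq hq1)) h2
  have h0 := qPochInf_self_ne_zero hq1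
  rw [← thetaSeries] at h
  field_simp at h
  rw [h]

lemma thetaSeries_mul_self {w q : ℂ} (hw : w ≠ 0) (hq : q ≠ 0) :
    thetaSeries (w * q) q = -w⁻¹ * thetaSeries w q := by
  rw [thetaSeries, thetaSeries, ← tsum_mul_left, ← (Equiv.addRight (1 : ℤ)).tsum_eq fun n =>
    -w⁻¹ * thetaTerm w q n]
  refine tsum_congr fun n => ?_
  rw [Equiv.coe_addRight, thetaTerm_add_one hw hq, thetaTerm_mul]
  field_simp

lemma thetaTrunc_eq_zero {w q : ℂ} (hw : w = 1 ∨ w = q) (hq : q ≠ 0) (hq1 : ‖q‖ < 1) (N : ℕ) :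
    thetaTrunc w q (N + 1) (N + 1) = 0 := by
  have hw0 : w ≠ 0 := by
    rcases hw with rfl | rfl
    exacts [one_ne_zero, hq]
  have h := thetaTrunc_mul_qPochN hw0 hq hq1 (N + 1)
  have h1 : qPochN 1 q (N + 1) = 0 := Finset.prod_eq_zero (i := 0) (by simp) (by simp)
  have h2 : qPochN w q (N + 1) * qPochN (q / w) q (N + 1) = 0 := by
    rcases hw with rfl | rfl
    · rw [h1, zero_mul]
    · rw [div_self hq, h1, mul_zero]
  rw [h2] at h
  exact_mod_cast (mul_eq_zero.1 h).resolve_right (qPochN_self_ne_zero hq1 _)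

/-- The series Σ (-1)^n q^{n(n+1)/2} / (1 - w q^n) truncated by the weights
`1/((q;q)_{N-n} (q;q)_{N+n})`. -/
def lerchTrunc (w q : ℂ) (N : ℤ) : ℂ :=
  ∑' n : ℤ, thetaTerm q q n / (1 - w * q ^ n) * (invPoch q (N - n) * invPoch q (N + n))

lemma lerchTrunc_add_one {w q : ℂ} (hw : w ≠ 0) (hq : q ≠ 0) (hq1 : ‖q‖ < 1)
    (hwq : ∀ n : ℤ, 1 - w * q ^ n ≠ 0) (N : ℕ) :
    lerchTrunc w q (N + 1) * ((1 - w * q ^ (N + 1)) * (1 - q / w * q ^ N))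
      = lerchTrunc w q N := by
  have hs := summable_mul_invPoch (summable_lerchTerm hq hw hq hq1) hq1
  have h1 := (hs (N + 1) (N + 1)).hasSum.mul_right ((1 - w * q ^ (N + 1)) * (1 - q / w * q ^ N))
  have h2 := (hs N N).hasSum
  have h3 := (summable_mul_invPoch (summable_thetaTerm one_ne_zero hq hq1) hq1
    (N + 1) (N + 1)).hasSum
  have h4 := (summable_mul_invPoch (summable_thetaTerm hq hq hq1) hq1
    (N + 1) (N + 1)).hasSum
  rw [← thetaTrunc, thetaTrunc_eq_zero (Or.inl rfl) hq hq1] at h3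
  rw [← thetaTrunc, thetaTrunc_eq_zero (Or.inr rfl) hq hq1] at h4
  have h5 := (h2.add (h3.mul_left (q ^ (N + 1)))).sub (h4.mul_left (q ^ (N + 1) / w))
  rw [mul_zero, mul_zero, add_zero, sub_zero] at h5
  refine h1.unique (h5.congr_fun fun n => ?_)
  have e1 := invPoch_mul_one_sub hq1 (N + 1 - n)
  have e2 := invPoch_mul_one_sub hq1 (N + 1 + n)
  have e3 : thetaTerm q q n = thetaTerm 1 q n * q ^ n := by rw [← thetaTerm_mul, one_mul]
  have e4 : q ^ ((N : ℤ) + 1) = q ^ (N + 1) := by exact_mod_cast zpow_natCast q (N + 1)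
  rw [zpow_sub₀ hq, e4] at e1
  rw [zpow_add₀ hq, e4] at e2
  rw [show (N : ℤ) - n = N + 1 - n - 1 by ring, ← e1, show (N : ℤ) + n = N + 1 + n - 1 by ring,
    ← e2, e3]
  have hd := hwq n
  have hy := zpow_ne_zero n hq
  generalize q ^ n = y at hd hy ⊢
  rw [mul_comm w y] at hd ⊢
  field_simp
  ring

lemma lerchTrunc_mul_qPochN {w q : ℂ} (hw : w ≠ 0) (hq : q ≠ 0) (hq1 : ‖q‖ < 1)
    (hwq : ∀ n : ℤ, 1 - w * q ^ n ≠ 0) (N : ℕ) :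
    lerchTrunc w q N * (qPochN w q (N + 1) * qPochN (q / w) q N) = 1 := by
  induction N with
  | zero =>
    rw [lerchTrunc, Nat.cast_zero, tsum_mul_invPoch_zero]
    have := hwq 0
    rw [zpow_zero, mul_one] at this
    simp [thetaTerm, qPochN, this]
  | succ N ih =>
    rw [← lerchTrunc_add_one hw hq hq1 hwq] at ih
    rw [qPochN_succ, qPochN_succ (q / w)]
    push_cast
    linear_combination ih

/-- The partial fraction expansion of the reciprocal theta function. -/
lemma thetaSeries_mul_lerchSeries {w q : ℂ} (hw : w ≠ 0) (hq : q ≠ 0) (hq1 : ‖q‖ < 1)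
    (hwq : ∀ n : ℤ, 1 - w * q ^ n ≠ 0) :
    thetaSeries w q * lerchSeries q w q = qPochInf q q ^ 3 := by
  have h1 := (tendsto_tsum_mul_invPoch (summable_lerchTerm hq hw hq hq1) hq1).mul
    (((tendsto_qPochN hq1 w).comp (tendsto_add_atTop_nat 1)).mul (tendsto_qPochN hq1 (q / w)))
  have h := tendsto_nhds_unique (h1.congr (lerchTrunc_mul_qPochN hw hq hq1 hwq)) tendsto_const_nhds
  rw [← lerchSeries] at h
  have h0 := qPochInf_self_ne_zero hq1
  rw [thetaSeries_eq hw hq hq1]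
  field_simp at h
  calc _ = qPochInf q q * (lerchSeries q w q * qPochInf w q * qPochInf (q / w) q) := by ring
    _ = _ := by
      rw [show lerchSeries q w q * qPochInf w q * qPochInf (q / w) q = qPochInf q q ^ 2 by
        rw [← h]]
      ring

lemma qPochN_three_mul (q : ℂ) (N : ℕ) :
    qPochN q q (3 * N) = qPochN q (q ^ 3) N * qPochN (q ^ 2) (q ^ 3) N
      * qPochN (q ^ 3) (q ^ 3) N := by
  induction N with
  | zero => simp [qPochN]
  | succ N ih =>
    rw [show 3 * (N + 1) = 3 * N + 1 + 1 + 1 by ring]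
    simp only [qPochN_succ, ih]
    ring

lemma thetaSeries_self_pow_three {q : ℂ} (hq : q ≠ 0) (hq1 : ‖q‖ < 1) :
    thetaSeries q (q ^ 3) = qPochInf q q := by
  have hq3 : ‖q ^ 3‖ < 1 := by
    rw [norm_pow]
    exact pow_lt_one₀ (norm_nonneg q) hq1 (by norm_num)
  rw [thetaSeries_eq hq (pow_ne_zero 3 hq) hq3, show q ^ 3 / q = q ^ 2 by field_simp]
  have h1 := ((tendsto_qPochN hq3 q).mul (tendsto_qPochN hq3 (q ^ 2))).mul
    (tendsto_qPochN hq3 (q ^ 3))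
  have h2 := (tendsto_qPochN hq1 q).comp (tendsto_id.const_mul_atTop' (show 0 < 3 by norm_num))
  rw [tendsto_nhds_unique (h2.congr (qPochN_three_mul q)) h1]
  ring

lemma jTheta_eq_thetaSeries (v τ : ℂ) :
    jTheta v τ = -I * Complex.exp (π * I * τ / 4 - π * I * v) *
      thetaSeries (Complex.exp (2 * π * I * v)) (Complex.exp (2 * π * I * τ)) := by
  have h := thetaSeries_mul_self (Complex.exp_ne_zero (2 * π * I * v))
    (Complex.exp_ne_zero (2 * π * I * τ))
  have h2 : jTheta v τ = I * Complex.exp (π * I * τ / 4 + π * I * v) *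
      thetaSeries (Complex.exp (2 * π * I * v) * Complex.exp (2 * π * I * τ))
        (Complex.exp (2 * π * I * τ)) := by
    rw [jTheta, thetaSeries, ← tsum_mul_left]
    refine tsum_congr fun n => ?_
    rw [← Complex.exp_add, thetaTerm_exp]
    have hI : ∀ x, I * Complex.exp x = Complex.exp (π / 2 * I + x) := fun x => by
      rw [Complex.exp_add, Complex.exp_pi_div_two_mul_I]
    rw [hI, ← Complex.exp_add]
    ring_nf
  rw [h2, h]
  have : Complex.exp (π * I * τ / 4 + π * I * v)
      = Complex.exp (π * I * τ / 4 - π * I * v) * Complex.exp (2 * π * I * v) := by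
    rw [← Complex.exp_add]
    ring_nf
  rw [this]
  have := Complex.exp_ne_zero (2 * π * I * v)
  field_simp

lemma jTheta_neg (v τ : ℂ) : jTheta (-v) τ = -jTheta v τ := by
  rw [jTheta, jTheta, ← tsum_neg, ← ((Equiv.neg ℤ).trans (Equiv.addRight (-1))).tsum_eq]
  refine tsum_congr fun n => ?_
  simp only [Equiv.trans_apply, Equiv.neg_apply, Equiv.coe_addRight]
  rw [← neg_one_mul (Complex.exp _), ← Complex.exp_pi_mul_I, ← Complex.exp_add, Complex.exp_eq_exp_iff_exists_int]
  refine ⟨-n - 1, ?_⟩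
  push_cast
  ring

lemma lerchMu_eq_lerchSeries (u v τ : ℂ) :
    lerchMu u v τ = Complex.exp (π * I * u) / jTheta v τ *
      lerchSeries (Complex.exp (2 * π * I * (v + τ))) (Complex.exp (2 * π * I * u))
        (Complex.exp (2 * π * I * τ)) := by
  rw [lerchMu, lerchSeries]
  congr 1
  refine tsum_congr fun n => ?_
  congr 1
  · rw [thetaTerm, mul_assoc ((-1) ^ n), ← Complex.exp_int_mul, ← Complex.exp_int_mul, ← Complex.exp_add,
      intCast_half_mul_pred]
    ring_nf
  · rw [← Complex.exp_int_mul, ← Complex.exp_add]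
    ring_nf

lemma dedekindEta_eq_qPochInf (τ : ℂ) :
    dedekindEta τ = Complex.exp (π * I * τ / 12) *
      qPochInf (Complex.exp (2 * π * I * τ)) (Complex.exp (2 * π * I * τ)) := by
  rw [dedekindEta, qPochInf]
  congr 1
  refine tprod_congr fun n => ?_
  rw [← pow_succ', ← Complex.exp_nat_mul]
  push_cast
  ring_nf

lemma norm_cexp_two_pi_I_mul_lt_one {τ : ℂ} (hτ : 0 < τ.im) :
    ‖Complex.exp (2 * π * I * τ)‖ < 1 := by
  rw [Complex.norm_exp, Real.exp_lt_one_iff]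
  have : (2 * π * I * τ).re = -(2 * π * τ.im) := by simp
  rw [this, neg_lt_zero]
  positivity

lemma jTheta_three_mul {τ : ℂ} (hτ : 0 < τ.im) :
    jTheta τ (3 * τ) = -I * Complex.exp (-(π * I * τ / 4)) *
      qPochInf (Complex.exp (2 * π * I * τ)) (Complex.exp (2 * π * I * τ)) := by
  have h3 : Complex.exp (2 * π * I * (3 * τ)) = Complex.exp (2 * π * I * τ) ^ 3 := by
    rw [← Complex.exp_nat_mul]
    push_cast
    ring_nf
  rw [jTheta_eq_thetaSeries, h3, thetaSeries_self_pow_three (Complex.exp_ne_zero _)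
    (norm_cexp_two_pi_I_mul_lt_one hτ)]
  ring_nf

/-- Splitting `1/(1-y) = (1+y+y²)/(1-y³)` in the rank generating function. -/
lemma rankStar_eq_lerchSeries {z q : ℂ} (hz : z ≠ 0) (hq : q ≠ 0) (hq1 : ‖q‖ < 1)
    (hzq : ∀ n : ℤ, 1 - z ^ 3 * (q ^ 3) ^ n ≠ 0) :
    rankStar z q = (qPochInf q q)⁻¹ * (lerchSeries (q ^ 2) (z ^ 3) (q ^ 3)
      + z * lerchSeries (q ^ 3) (z ^ 3) (q ^ 3) + z ^ 2 * lerchSeries (q ^ 4) (z ^ 3) (q ^ 3)) := by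
  have hq3 : ‖q ^ 3‖ < 1 := by
    rw [norm_pow]
    exact pow_lt_one₀ (norm_nonneg q) hq1 (by norm_num)
  have hs := fun k : ℕ => (summable_lerchTerm (pow_ne_zero k hq) (pow_ne_zero 3 hz)
    (pow_ne_zero 3 hq) hq3).hasSum
  rw [rankStar]
  congr 1
  refine ((((hs 2).add ((hs 3).mul_left z)).add ((hs 4).mul_left (z ^ 2))).congr_fun
    fun n => ?_).tsum_eq
  have e1 : q ^ (n * (3 * n + 1) / 2) = (q ^ 3) ^ (n * (n - 1) / 2) * (q ^ n) ^ 2 := by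
    obtain ⟨k, hk⟩ := Int.even_mul_pred_self n
    rw [show n * (n - 1) / 2 = k by omega,
      show n * (3 * n + 1) / 2 = 3 * k + n * 2 by
        have : n * (3 * n + 1) = 3 * (n * (n - 1)) + 4 * n := by ring
        omega,
      zpow_add₀ hq, zpow_mul, zpow_mul]
    norm_cast
  have e2 : ∀ k : ℕ, (q ^ k) ^ n = (q ^ n) ^ k := fun k => by
    rw [← zpow_natCast, ← zpow_mul, ← zpow_natCast, ← zpow_mul, mul_comm]
  have hd := hzq n
  simp only [thetaTerm, e1, e2] at hd ⊢
  have hd1 : 1 - z * q ^ n ≠ 0 := fun h => hd (by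
    rw [← mul_pow, ← sub_eq_zero.1 h, one_pow, sub_self])
  generalize q ^ n = y at hd hd1 ⊢
  simp only [← mul_div_assoc, ← add_div]
  rw [div_eq_div_iff hd1 hd]
  ring

/-- Decomposition of R* into Lerch sums. -/
theorem rankStar_decomposition (τ u : ℂ) (hτ : 0 < τ.im)
    (hu : ∀ m n : ℤ, u ≠ (m : ℂ) * τ + (n : ℂ) / 3) :
    rankStar (Complex.exp (2 * π * I * u)) (Complex.exp (2 * π * I * τ))
    = I * Complex.exp (-3 * π * I * u - π * I * τ / 4) * lerchMu (3 * u) (-τ) (3 * τ)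
      - I * Complex.exp (π * I * u - π * I * τ / 4) * lerchMu (3 * u) τ (3 * τ)
      - I * Complex.exp (-π * I * u + π * I * τ / 12) * dedekindEta (3 * τ) ^ 3 /
          (dedekindEta τ * jTheta (3 * u) (3 * τ)) := by
  have hq1 := norm_cexp_two_pi_I_mul_lt_one hτ
  have hq3 : ‖Complex.exp (2 * π * I * τ) ^ 3‖ < 1 := by
    rw [norm_pow]
    exact pow_lt_one₀ (norm_nonneg _) hq1 (by norm_num)
  have hpow : ∀ (k : ℕ) (x : ℂ), Complex.exp (2 * π * I * x) ^ k
      = Complex.exp (2 * π * I * (k * x)) := fun k x => by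
    rw [← Complex.exp_nat_mul]
    ring_nf
  have hzq : ∀ n : ℤ, 1 - Complex.exp (2 * π * I * u) ^ 3 * (Complex.exp (2 * π * I * τ) ^ 3) ^ n
      ≠ 0 := by
    intro n hn
    rw [sub_eq_zero, eq_comm, ← Complex.exp_nat_mul, ← Complex.exp_nat_mul, ← Complex.exp_int_mul,
      ← Complex.exp_add, Complex.exp_eq_one_iff] at hn
    obtain ⟨m, hm⟩ := hn
    refine hu (-n) m ?_
    have : (π : ℂ) ≠ 0 := by exact_mod_cast Real.pi_ne_zero
    have h2 : 2 * π * I * (3 * u + 3 * n * τ - m) = 0 := by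
      push_cast at hm
      linear_combination hm
    have h3 := (mul_eq_zero.1 h2).resolve_left two_pi_I_ne_zero
    push_cast
    linear_combination h3 / 3
  have hPF := thetaSeries_mul_lerchSeries (pow_ne_zero 3 (Complex.exp_ne_zero (2 * π * I * u)))
    (pow_ne_zero 3 (Complex.exp_ne_zero (2 * π * I * τ))) hq3 hzq
  have hP0 := qPochInf_self_ne_zero hq1
  have hP3 := qPochInf_self_ne_zero hq3
  have hΘ := left_ne_zero_of_mul (hPF ▸ pow_ne_zero 3 hP3)
  rw [rankStar_eq_lerchSeries (Complex.exp_ne_zero _) (Complex.exp_ne_zero _) hq1 hzq,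
    lerchMu_eq_lerchSeries, lerchMu_eq_lerchSeries, jTheta_neg, jTheta_three_mul hτ,
    dedekindEta_eq_qPochInf, dedekindEta_eq_qPochInf, jTheta_eq_thetaSeries,
    show -τ + 3 * τ = (2 : ℕ) * τ by push_cast; ring,
    show τ + 3 * τ = (4 : ℕ) * τ by push_cast; ring,
    show (3 : ℂ) * τ = (3 : ℕ) * τ by push_cast; rfl,
    show (3 : ℂ) * u = (3 : ℕ) * u by push_cast; rfl, ← hpow, ← hpow, ← hpow, ← hpow]
  rw [eq_div_of_mul_eq hΘ ((mul_comm _ _).trans hPF)]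
  have e1 : Complex.exp (-3 * π * I * u - π * I * τ / 4) * Complex.exp (π * I * ((3 : ℕ) * u))
      = Complex.exp (-(π * I * τ / 4)) := by
    rw [← Complex.exp_add]
    push_cast
    ring_nf
  have e2 : Complex.exp (π * I * u - π * I * τ / 4) * Complex.exp (π * I * ((3 : ℕ) * u))
      = Complex.exp (2 * π * I * u) ^ 2 * Complex.exp (-(π * I * τ / 4)) := by
    rw [← Complex.exp_nat_mul, ← Complex.exp_add, ← Complex.exp_add]
    push_cast
    ring_nf
  have e3 : Complex.exp (-π * I * u + π * I * τ / 12)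
        * Complex.exp (π * I * ((3 : ℕ) * τ) / 12) ^ 3
      = Complex.exp (2 * π * I * u) * (Complex.exp (π * I * τ / 12)
        * Complex.exp (π * I * ((3 : ℕ) * τ) / 4 - π * I * ((3 : ℕ) * u))) := by
    rw [← Complex.exp_nat_mul, ← Complex.exp_add, ← Complex.exp_add, ← Complex.exp_add]
    push_cast
    ring_nf
  have n1 := Complex.exp_ne_zero (-(π * I * τ / 4))
  have n2 := Complex.exp_ne_zero (π * I * τ / 12)
  have n3 := Complex.exp_ne_zero (π * I * ((3 : ℕ) * τ) / 4 - π * I * ((3 : ℕ) * u))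
  clear hu hpow hzq
  generalize Complex.exp (2 * π * I * u) = z at *
  generalize Complex.exp (2 * π * I * τ) = q at *
  generalize qPochInf q q = P at *
  generalize qPochInf (q ^ 3) (q ^ 3) = P₃ at *
  generalize thetaSeries (z ^ 3) (q ^ 3) = T at *
  generalize Complex.exp (-(π * I * τ / 4)) = E at *
  generalize Complex.exp (-3 * π * I * u - π * I * τ / 4) = A₁ at *
  generalize Complex.exp (π * I * u - π * I * τ / 4) = A₂ at *
  generalize Complex.exp (-π * I * u + π * I * τ / 12) = A₃ at *
  generalize Complex.exp (π * I * ((3 : ℕ) * u)) = B at *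
  generalize Complex.exp (π * I * τ / 12) = D at *
  generalize Complex.exp (π * I * ((3 : ℕ) * τ) / 12) = D₃ at *
  generalize Complex.exp (π * I * ((3 : ℕ) * τ) / 4 - π * I * ((3 : ℕ) * u)) = F at *
  have hI := I_ne_zero
  have t₁ : ∀ S, I * A₁ * (B / -(-I * E * P) * S) = P⁻¹ * S := fun S => by
    field_simp
    linear_combination S * e1
  have t₂ : ∀ S, I * A₂ * (B / (-I * E * P) * S) = -(P⁻¹ * (z ^ 2 * S)) := fun S => by
    field_simp
    linear_combination -S * e2
  have t₃ : I * A₃ * (D₃ * P₃) ^ 3 / (D * P * (-I * F * T)) = -(P⁻¹ * (z * (P₃ ^ 3 / T))) := by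
    field_simp
    linear_combination -e3
  rw [t₁, t₂, t₃]
  ring

end
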